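/- In the one-mass-point case, for every integer n with 1 ≤ n ≤ N and every s, the polynomial R_n^{α,β,A}(s)_q = R_n^{α,β}(s)_q − A R_n^{α,β,A}(0)_q K_{n−1}^{α,β}(s,0), with R_n^{α,β,A}(0)_q = R_n^{α,β}(0)_q / (1 + A K_{n−1}^{α,β}(0,0)) (assuming 1 + A K_{n−1}^{α,β}(0,0) ≠ 0), satisfies φ₀(s) R_n^{α,β,A}(s)_q = A(s,n) R_n^{α,β}(s)_q + B(s,n) R_{n−1}^{α,β}(s)_q, where φ₀(s) = (q^{−s} − 1)(1 − δγq^{s+1}), A(s,n) = φ₀(s) − (A/d_{n−1}²) R_n^{α,β,A}(0)_q R_{n−1}^{α,β}(0)_q, and B(s,n) = (A/d_{n−1}²) R_n^{α,β,A}(0)_q R_n^{α,β}(0)_q. -/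

import Mathlib

open Finset Filter

set_option autoImplicit false

noncomputable section

/-- The `q`-Pochhammer symbol `(a;q)_k = ∏_{i=0}^{k-1} (1 - a q^i)`. -/
def qPoch (a q : ℂ) (k : ℕ) : ℂ := ∏ i ∈ Finset.range k, (1 - a * q ^ i)

/-- The lattice `x(s) = q^{-s} + δ γ q^{s+1}`. -/
def qLat (q γ δ : ℂ) (s : ℤ) : ℂ := q ^ (-s) + δ * γ * q ^ (s + 1)

/-- The standard (monic-normalized as in the paper) `q`-Racah polynomial
`R_n^{α,β}(s)_q` evaluated at an integer lattice point `s`. -/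
def qRacah (q α β γ δ : ℂ) (n : ℕ) (s : ℤ) : ℂ :=
  (qPoch (α * q) q n * qPoch (β * δ * q) q n * qPoch (γ * q) q n /
      qPoch (α * β * q ^ ((n : ℤ) + 1)) q n) *
    ∑ k ∈ Finset.range (n + 1),
      qPoch (q ^ (-(n : ℤ))) q k * qPoch (α * β * q ^ ((n : ℤ) + 1)) q k *
          qPoch (q ^ (-s)) q k * qPoch (δ * γ * q ^ (s + 1)) q k /
        (qPoch (α * q) q k * qPoch (β * δ * q) q k * qPoch (γ * q) q k * qPoch q q k) *
        q ^ k

/-- The squared norm `d_n²` of the standard `q`-Racah polynomials. -/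
def qRacahNormSq (q α β γ δ : ℂ) (n : ℕ) : ℂ :=
  (1 - α * β * q) * (δ * γ * q) ^ n / (1 - α * β * q ^ (2 * (n : ℤ) + 1)) *
    (qPoch (α * q) q n * qPoch (β * δ * q) q n * qPoch (γ * q) q n * qPoch q q n *
      qPoch (q * α * β * γ⁻¹) q n * qPoch (α * δ⁻¹ * q) q n * qPoch (β * q) q n) /
    (qPoch (α * β * q) q n * qPoch (α * β * q ^ ((n : ℤ) + 1)) q n *
      qPoch (α * β * q ^ ((n : ℤ) + 1)) q n)

/-- The kernel `K_{n-1}^{α,β}(s,t) = ∑_{k=0}^{n-1} R_k(s) R_k(t) / d_k²`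
(the index `n` here denotes the number of summands, so `qKer q α β γ δ n = K_{n-1}`). -/
def qKer (q α β γ δ : ℂ) (n : ℕ) (s t : ℤ) : ℂ :=
  ∑ k ∈ Finset.range n,
    qRacah q α β γ δ k s * qRacah q α β γ δ k t / qRacahNormSq q α β γ δ k

/-- `κ_{n-1}(s,t)` (with the same index convention as `qKer`). -/
def qKappa (q α β γ δ A B : ℂ) (n : ℕ) (s t : ℤ) : ℂ :=
  1 + A * qKer q α β γ δ n s s + B * qKer q α β γ δ n t t +
    A * B * (qKer q α β γ δ n s s * qKer q α β γ δ n t t - (qKer q α β γ δ n s t) ^ 2)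

/-- The value `R_n^{α,β,A,B}(0)_q` of the `q`-Racah–Krall polynomial at `s = 0`. -/
def qKrall0 (q α β γ δ A B : ℂ) (N n : ℕ) : ℂ :=
  ((1 + B * qKer q α β γ δ n N N) * qRacah q α β γ δ n 0 -
      B * qKer q α β γ δ n 0 N * qRacah q α β γ δ n N) / qKappa q α β γ δ A B n 0 N

/-- The value `R_n^{α,β,A,B}(N)_q` of the `q`-Racah–Krall polynomial at `s = N`. -/
def qKrallN (q α β γ δ A B : ℂ) (N n : ℕ) : ℂ :=
  (-(A * qKer q α β γ δ n N 0 * qRacah q α β γ δ n 0) +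
      (1 + A * qKer q α β γ δ n 0 0) * qRacah q α β γ δ n N) / qKappa q α β γ δ A B n 0 N

/-- The `q`-Racah–Krall polynomial `R_n^{α,β,A,B}(s)_q`. -/
def qRacahKrall (q α β γ δ A B : ℂ) (N n : ℕ) (s : ℤ) : ℂ :=
  qRacah q α β γ δ n s - A * qKrall0 q α β γ δ A B N n * qKer q α β γ δ n s 0 -
    B * qKrallN q α β γ δ A B N n * qKer q α β γ δ n s N

/-- The value `R_n^{α,β,A}(0)_q` of the one-mass-point q-Racah–Krall polynomial at `s=0`. -/
def qKrallA0 (q α β γ δ A : ℂ) (n : ℕ) : ℂ :=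
  qRacah q α β γ δ n 0 / (1 + A * qKer q α β γ δ n 0 0)

/-- The one-mass-point q-Racah–Krall polynomial `R_n^{α,β,A}(s)_q`. -/
def qRacahKrallA (q α β γ δ A : ℂ) (n : ℕ) (s : ℤ) : ℂ :=
  qRacah q α β γ δ n s - A * qKrallA0 q α β γ δ A n * qKer q α β γ δ n s 0

lemma qPoch_zero (a q : ℂ) : qPoch a q 0 = 1 := by simp [qPoch]

lemma qPoch_succ (a q : ℂ) (k : ℕ) : qPoch a q (k + 1) = qPoch a q k * (1 - a * q ^ k) := by
  simp [qPoch, Finset.prod_range_succ]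

lemma qPoch_succ_left (a q : ℂ) (k : ℕ) : qPoch a q (k + 1) = (1 - a) * qPoch (a * q) q k := by
  simp only [qPoch, Finset.prod_range_succ', pow_zero, mul_one, pow_succ']
  rw [mul_comm]
  simp only [mul_assoc]

lemma one_sub_mul_qPoch (a q : ℂ) (k : ℕ) :
    (1 - a) * qPoch (a * q) q k = qPoch a q k * (1 - a * q ^ k) := by
  rw [← qPoch_succ_left, qPoch_succ]

lemma one_sub_ne_zero_of_qPoch {a q : ℂ} {k i : ℕ} (h : qPoch a q k ≠ 0) (hi : i < k) :
    1 - a * q ^ i ≠ 0 :=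
  Finset.prod_ne_zero_iff.1 h i (Finset.mem_range.2 hi)

lemma qPoch_inv_pow_eq_zero {q : ℂ} (hq : q ≠ 0) {n k : ℕ} (h : n < k) :
    qPoch ((q ^ n)⁻¹) q k = 0 := by
  refine Finset.prod_eq_zero (Finset.mem_range.2 h) ?_
  rw [inv_mul_cancel₀ (pow_ne_zero _ hq), sub_self]

lemma qPoch_one_eq_zero (q : ℂ) (k : ℕ) : qPoch 1 q (k + 1) = 0 := by
  simp [qPoch_succ_left]

/-- The coefficient `(b⁻¹;q)_k (c b q;q)_k`, which for `b = q^n` is the `n`-dependent part of the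
`k`-th summand of a `q`-Racah polynomial. -/
def qUpper (c q b : ℂ) (k : ℕ) : ℂ := qPoch b⁻¹ q k * qPoch (c * b * q) q k

/-- The denominator of the `k`-th summand of a `q`-Racah polynomial. -/
def qLower (q α β γ δ : ℂ) (k : ℕ) : ℂ :=
  qPoch (α * q) q k * qPoch (β * δ * q) q k * qPoch (γ * q) q k * qPoch q q k

/-- The `_4φ_3` sum truncated after the index `L`. -/
def qSum (q α β γ δ y z b : ℂ) (L : ℕ) : ℂ :=
  ∑ k ∈ Finset.range (L + 1),
    qUpper (α * β) q b k * (qPoch y q k * qPoch z q k) / qLower q α β γ δ k * q ^ k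

/-- The coefficient `A_n` of the `q`-Racah recurrence, with `b = q^n`. -/
def qRecA (q α β γ δ b : ℂ) : ℂ :=
  (1 - α * β * b * q) * ((1 - α * q * b) * (1 - β * δ * q * b) * (1 - γ * q * b) /
    ((1 - α * β * q * b ^ 2) * (1 - α * β * q ^ 2 * b ^ 2)))

/-- The coefficient `C_n` of the `q`-Racah recurrence, with `b = q^n`. -/
def qRecC (q α β γ δ b : ℂ) : ℂ :=
  (1 - b) * (q * (1 - β * b) * (γ - α * β * b) * (δ - α * b) /
    ((1 - α * β * b ^ 2) * (1 - α * β * q * b ^ 2)))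

lemma qUpper_shift_up {q b : ℂ} (hq : q ≠ 0) (c : ℂ) (k : ℕ) :
    (1 - c * b * q) * qUpper c q (b * q) (k + 1) =
      qUpper c q b k *
        ((1 - b⁻¹ * q⁻¹) * (1 - c * b * q * q ^ k) * (1 - c * b * q * q * q ^ k)) := by
  have h := one_sub_mul_qPoch (c * b * q) q k
  have e : (b * q)⁻¹ * q = b⁻¹ := by rw [mul_inv, mul_assoc, inv_mul_cancel₀ hq, mul_one]
  unfold qUpper
  rw [qPoch_succ_left (b * q)⁻¹, e, qPoch_succ, ← mul_assoc c, mul_inv]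
  linear_combination (1 - b⁻¹ * q⁻¹) * qPoch b⁻¹ q k * (1 - c * b * q * q * q ^ k) * h

lemma qUpper_shift_down {q b : ℂ} (hq : q ≠ 0) (c : ℂ) (k : ℕ) :
    (1 - b⁻¹) * qUpper c q (b / q) (k + 1) =
      qUpper c q b k * ((1 - b⁻¹ * q ^ k) * (1 - b⁻¹ * q * q ^ k) * (1 - c * b)) := by
  have h := one_sub_mul_qPoch b⁻¹ q k
  have e : (b / q)⁻¹ = b⁻¹ * q := by rw [inv_div, div_eq_mul_inv, mul_comm]
  have e' : c * (b / q) * q = c * b := by field_simp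
  unfold qUpper
  rw [e, e', qPoch_succ, qPoch_succ_left (c * b)]
  linear_combination (1 - b⁻¹ * q * q ^ k) * (1 - c * b) * qPoch (c * b * q) q k * h

lemma qUpper_succ (c q b : ℂ) (k : ℕ) :
    qUpper c q b (k + 1) =
      qUpper c q b k * ((1 - b⁻¹ * q ^ k) * (1 - c * b * q * q ^ k)) := by
  unfold qUpper
  rw [qPoch_succ, qPoch_succ]
  ring

lemma qLower_succ (q α β γ δ : ℂ) (k : ℕ) :
    qLower q α β γ δ (k + 1) = qLower q α β γ δ k *
      ((1 - α * q * q ^ k) * (1 - β * δ * q * q ^ k) * (1 - γ * q * q ^ k) * (1 - q * q ^ k)) := by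
  simp only [qLower, qPoch_succ]
  ring

/-- Comparison of coefficients in the `q`-Racah recurrence. -/
lemma qUpper_recurrence {q b : ℂ} (hq : q ≠ 0) (hb : b ≠ 0) (α β γ δ : ℂ)
    (h0 : 1 - α * β * b ^ 2 ≠ 0) (h1 : 1 - α * β * q * b ^ 2 ≠ 0)
    (h2 : 1 - α * β * q ^ 2 * b ^ 2 ≠ 0) (k : ℕ) :
    (qRecA q α β γ δ b * (qUpper (α * β) q (b * q) (k + 1) - qUpper (α * β) q b (k + 1)) +
        qRecC q α β γ δ b * (qUpper (α * β) q (b / q) (k + 1) - qUpper (α * β) q b (k + 1))) *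
        (q * q ^ k) =
      qUpper (α * β) q b (k + 1) * ((1 - q * q ^ k) * (1 - δ * γ * q * (q * q ^ k))) -
        qUpper (α * β) q b k * ((1 - α * q * q ^ k) * (1 - β * δ * q * q ^ k) *
          (1 - γ * q * q ^ k) * (1 - q * q ^ k)) := by
  have hu := qUpper_shift_up (b := b) hq (α * β) k
  have hd := qUpper_shift_down (b := b) hq (α * β) k
  have hs := qUpper_succ (α * β) q b k
  generalize q ^ k = X at *
  generalize qUpper (α * β) q b k = v at *
  generalize qUpper (α * β) q b (k + 1) = F at *
  generalize qUpper (α * β) q (b * q) (k + 1) = Fu at *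
  generalize qUpper (α * β) q (b / q) (k + 1) = Fd at *
  have hA : qRecA q α β γ δ b * (Fu - F) =
      -(v * (1 - q * X) * (1 - α * β * b * q * X) *
        ((1 - α * q * b) * (1 - β * δ * q * b) * (1 - γ * q * b))) /
        (b * q * (1 - α * β * q * b ^ 2)) := by
    have : (1 - α * β * b * q) * (Fu - F) =
        -(v * (1 - q * X) * (1 - α * β * b * q * X) * (1 - α * β * q ^ 2 * b ^ 2)) /
          (b * q) := by
      rw [mul_sub, hu, hs]; field_simp; ring
    unfold qRecA
    rw [mul_right_comm, this]
    generalize 1 - α * β * q ^ 2 * b ^ 2 = T2 at *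
    generalize 1 - α * β * q * b ^ 2 = T1 at *
    field_simp
  have hC : qRecC q α β γ δ b * (Fd - F) =
      -(v * (1 - b⁻¹ * X) * (1 - q * X) *
        (q * (1 - β * b) * (γ - α * β * b) * (δ - α * b))) / (1 - α * β * q * b ^ 2) := by
    have : (1 - b) * (Fd - F) =
        -(v * (1 - b⁻¹ * X) * (1 - q * X) * (1 - α * β * b ^ 2)) := by
      have e : (1 - b) = -b * (1 - b⁻¹) := by field_simp; ring
      rw [e, mul_assoc, mul_sub, hd, hs]; field_simp; ring
    unfold qRecC
    rw [mul_right_comm, this]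
    generalize 1 - α * β * b ^ 2 = T0 at *
    generalize 1 - α * β * q * b ^ 2 = T1 at *
    field_simp
  rw [add_mul, hA, hC, hs]
  generalize hT : 1 - α * β * q * b ^ 2 = T at *
  field_simp
  rw [← hT]
  ring

/-- The `q`-Racah recurrence for truncated sums, with its explicit remainder. -/
lemma qSum_recurrence {q b : ℂ} (hq : q ≠ 0) (hb : b ≠ 0) (α β γ δ y z : ℂ)
    (hyz : y * z = δ * γ * q)
    (h0 : 1 - α * β * b ^ 2 ≠ 0) (h1 : 1 - α * β * q * b ^ 2 ≠ 0)
    (h2 : 1 - α * β * q ^ 2 * b ^ 2 ≠ 0) (L : ℕ)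
    (hL : ∀ k ≤ L, qLower q α β γ δ k ≠ 0) :
    (y - 1) * (1 - z) * qSum q α β γ δ y z b L -
        qRecA q α β γ δ b * (qSum q α β γ δ y z (b * q) L - qSum q α β γ δ y z b L) -
        qRecC q α β γ δ b * (qSum q α β γ δ y z (b / q) L - qSum q α β γ δ y z b L) =
      -(qUpper (α * β) q b L * (qPoch y q (L + 1) * qPoch z q (L + 1)) /
        qLower q α β γ δ L) := by
  induction L with
  | zero => simp [qSum, qUpper, qLower, qPoch]; ring
  | succ L ih =>
    have ih := ih fun k hk => hL k (by omega)
    have hr := qUpper_recurrence hq hb α β γ δ h0 h1 h2 L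
    have hD := hL (L + 1) le_rfl
    have hl := qLower_succ q α β γ δ L
    have hv : qUpper (α * β) q b L / qLower q α β γ δ L =
        qUpper (α * β) q b L * ((1 - α * q * q ^ L) * (1 - β * δ * q * q ^ L) *
          (1 - γ * q * q ^ L) * (1 - q * q ^ L)) / qLower q α β γ δ (L + 1) := by
      have hDL := hL L (by omega)
      rw [div_eq_div_iff hDL hD, hl]
      ring
    have hS (b' : ℂ) : qSum q α β γ δ y z b' (L + 1) = qSum q α β γ δ y z b' L +
        qUpper (α * β) q b' (L + 1) * (qPoch y q (L + 1) * qPoch z q (L + 1)) /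
          qLower q α β γ δ (L + 1) * q ^ (L + 1) := by
      rw [qSum, Finset.sum_range_succ, qSum]
    rw [mul_div_right_comm, hv] at ih
    rw [hS, hS, hS, qPoch_succ y q (L + 1), qPoch_succ z q (L + 1), pow_succ']
    simp only [div_eq_mul_inv (_ : ℂ) (qLower q α β γ δ (L + 1))] at ih ⊢
    linear_combination ih - qPoch y q (L + 1) * qPoch z q (L + 1) *
      (qLower q α β γ δ (L + 1))⁻¹ * hr + qUpper (α * β) q b (L + 1) * qPoch y q (L + 1) *
      qPoch z q (L + 1) * (qLower q α β γ δ (L + 1))⁻¹ * (q * q ^ L) * (q * q ^ L - 1) * hyz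

/-- The value of a `q`-Racah polynomial at `s = 0`. -/
def qRacahZero (q α β γ δ : ℂ) (n : ℕ) : ℂ :=
  qPoch (α * q) q n * qPoch (β * δ * q) q n * qPoch (γ * q) q n /
    qPoch (α * β * q ^ (n + 1)) q n

lemma qRacah_eq {q : ℂ} (hq : q ≠ 0) (α β γ δ : ℂ) (n L : ℕ) (hL : n ≤ L) (s : ℤ) :
    qRacah q α β γ δ n s = qRacahZero q α β γ δ n *
      qSum q α β γ δ (q ^ (-s)) (δ * γ * q ^ (s + 1)) (q ^ n) L := by
  have e : (q : ℂ) ^ ((n : ℤ) + 1) = q ^ (n + 1) := by exact_mod_cast zpow_natCast q (n + 1)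
  unfold qRacah qRacahZero qSum qUpper qLower
  rw [e, zpow_neg, zpow_natCast]
  congr 1
  rw [← Finset.sum_subset (Finset.range_mono (show n + 1 ≤ L + 1 by omega))]
  · refine Finset.sum_congr rfl fun k _ => ?_
    rw [mul_assoc (α * β), ← pow_succ]
    ring
  · intro k _ hk
    rw [qPoch_inv_pow_eq_zero hq (by simpa using hk)]
    simp

lemma qSum_zero_right (q α β γ δ z b : ℂ) (L : ℕ) : qSum q α β γ δ 1 z b L = 1 := by
  rw [qSum, Finset.sum_range_succ']
  simp [qPoch_one_eq_zero, qUpper, qLower, qPoch_zero]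

lemma qRacah_zero {q : ℂ} (hq : q ≠ 0) (α β γ δ : ℂ) (n : ℕ) :
    qRacah q α β γ δ n 0 = qRacahZero q α β γ δ n := by
  rw [qRacah_eq hq α β γ δ n n le_rfl]
  simp [qSum_zero_right]

lemma qPoch_leading_succ (c q : ℂ) (n : ℕ) :
    (1 - c * q ^ (n + 1)) * qPoch (c * q ^ (n + 2)) q (n + 1) =
      qPoch (c * q ^ (n + 1)) q n *
        ((1 - c * q * (q ^ n) ^ 2) * (1 - c * q ^ 2 * (q ^ n) ^ 2)) := by
  have h := one_sub_mul_qPoch (c * q ^ (n + 1)) q (n + 1)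
  rw [qPoch_succ (c * q ^ (n + 1)) q n, mul_assoc c (q ^ (n + 1)) q, ← pow_succ] at h
  rw [h]
  ring

lemma qRacahZero_succ (q α β γ δ : ℂ) (n : ℕ)
    (h : 1 - α * β * q ^ (n + 1) ≠ 0)
    (h' : qPoch (α * β * q ^ (n + 1)) q n ≠ 0) :
    qRacahZero q α β γ δ (n + 1) = qRecA q α β γ δ (q ^ n) * qRacahZero q α β γ δ n := by
  have e := qPoch_leading_succ (α * β) q n
  have e' : qPoch (α * β * q ^ (n + 2)) q (n + 1) = qPoch (α * β * q ^ (n + 1)) q n *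
        ((1 - α * β * q * (q ^ n) ^ 2) * (1 - α * β * q ^ 2 * (q ^ n) ^ 2)) /
          (1 - α * β * q ^ (n + 1)) := by
    rw [← e]; field_simp
  unfold qRacahZero qRecA
  rw [show n + 1 + 1 = n + 2 from rfl, e', qPoch_succ, qPoch_succ, qPoch_succ,
    mul_assoc (α * β) (q ^ n), ← pow_succ]
  field_simp

lemma qRacahNormSq_eq (q α β γ δ : ℂ) (n : ℕ) :
    qRacahNormSq q α β γ δ n =
      (1 - α * β * q) * (δ * γ * q) ^ n / (1 - α * β * q * (q ^ n) ^ 2) *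
    (qPoch (α * q) q n * qPoch (β * δ * q) q n * qPoch (γ * q) q n * qPoch q q n *
      qPoch (q * α * β * γ⁻¹) q n * qPoch (α * δ⁻¹ * q) q n * qPoch (β * q) q n) /
    (qPoch (α * β * q) q n * qPoch (α * β * q ^ (n + 1)) q n *
      qPoch (α * β * q ^ (n + 1)) q n) := by
  have e : (q : ℂ) ^ ((n : ℤ) + 1) = q ^ (n + 1) := by exact_mod_cast zpow_natCast q (n + 1)
  have e' : (q : ℂ) ^ (2 * (n : ℤ) + 1) = q * (q ^ n) ^ 2 := by
    rw [show q * (q ^ n) ^ 2 = q ^ (2 * n + 1) by ring]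
    exact_mod_cast zpow_natCast q (2 * n + 1)
  rw [qRacahNormSq, e, e', ← mul_assoc (α * β) q]

lemma qRacahNormSq_succ (q α β γ δ : ℂ) (n : ℕ) (hγ : γ ≠ 0) (hδ : δ ≠ 0)
    (h : 1 - α * β * q ^ (n + 1) ≠ 0)
    (h' : qPoch (α * β * q ^ (n + 1)) q n ≠ 0)
    (hp : qPoch (α * β * q) q n ≠ 0)
    (h1 : 1 - α * β * q * (q ^ n) ^ 2 ≠ 0) (h2 : 1 - α * β * q ^ 2 * (q ^ n) ^ 2 ≠ 0)
    (h3 : 1 - α * β * q * (q ^ (n + 1)) ^ 2 ≠ 0) :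
    qRacahNormSq q α β γ δ (n + 1) =
      qRecA q α β γ δ (q ^ n) * qRecC q α β γ δ (q ^ (n + 1)) * qRacahNormSq q α β γ δ n := by
  have e := qPoch_leading_succ (α * β) q n
  have e' : qPoch (α * β * q ^ (n + 2)) q (n + 1) = qPoch (α * β * q ^ (n + 1)) q n *
        ((1 - α * β * q * (q ^ n) ^ 2) * (1 - α * β * q ^ 2 * (q ^ n) ^ 2)) /
          (1 - α * β * q ^ (n + 1)) := by
    rw [← e]; field_simp
  rw [qRacahNormSq_eq, qRacahNormSq_eq]
  unfold qRecA qRecC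
  rw [show n + 1 + 1 = n + 2 from rfl, e']
  simp only [qPoch_succ]
  generalize qPoch (α * β * q ^ (n + 1)) q n = E at *
  generalize qPoch (α * β * q) q n = G at *
  generalize qPoch (α * q) q n = G1 at *
  generalize qPoch (β * δ * q) q n = G2 at *
  generalize qPoch (γ * q) q n = G3 at *
  generalize qPoch q q n = G4 at *
  generalize qPoch (q * α * β * γ⁻¹) q n = G5 at *
  generalize qPoch (α * δ⁻¹ * q) q n = G6 at *
  generalize qPoch (β * q) q n = G7 at *
  simp only [pow_succ (δ * γ * q) n, pow_succ q n] at *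
  generalize (δ * γ * q) ^ n = H at *
  generalize q ^ n = X at *
  have hc : γ - α * β * (X * q) = γ * (1 - q * α * β * γ⁻¹ * X) := by field_simp
  have hd : δ - α * (X * q) = δ * (1 - α * δ⁻¹ * q * X) := by field_simp
  rw [hc, hd, show α * β * (X * q) ^ 2 = α * β * q ^ 2 * X ^ 2 by ring,
    show β * (X * q) = β * q * X by ring, show X * q = q * X by ring,
    show α * β * X * q = α * β * (q * X) by ring, show α * β * q * X = α * β * (q * X) by ring]
  rw [mul_comm X q] at h h3
  generalize 1 - α * β * q * (q * X) ^ 2 = T3 at *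
  generalize 1 - α * β * q ^ 2 * X ^ 2 = T2 at *
  generalize 1 - α * β * q * X ^ 2 = T1 at *
  generalize 1 - α * β * (q * X) = T0 at *
  generalize 1 - q * α * β * γ⁻¹ * X = U1 at *
  generalize 1 - α * δ⁻¹ * q * X = U2 at *
  generalize 1 - α * q * X = U3 at *
  generalize 1 - β * δ * q * X = U4 at *
  generalize 1 - γ * q * X = U5 at *
  generalize 1 - q * X = U6 at *
  generalize 1 - β * q * X = U7 at *
  generalize 1 - α * β * q = U8 at *
  have cancel (u v w : ℂ) : u * v / T3 * w / (G * T0 * (E * (T1 * T2) / T0) *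
      (E * (T1 * T2) / T0)) = T0 / (T1 * T2) / (T2 * T3) * (u * v / T1 * w / (G * E * E)) := by
    field_simp
  rw [cancel]
  ring

/-- The three-term recurrence of the `q`-Racah polynomials. -/
lemma qRacah_recurrence {q : ℂ} (hq : q ≠ 0) (α β γ δ : ℂ) (n : ℕ)
    (hL : ∀ k ≤ n + 2, qLower q α β γ δ k ≠ 0)
    (ha : 1 - α * β * q ^ (n + 1) ≠ 0) (hb : 1 - α * β * q ^ (n + 2) ≠ 0)
    (hP : qPoch (α * β * q ^ (n + 1)) q n ≠ 0)
    (hP' : qPoch (α * β * q ^ (n + 2)) q (n + 1) ≠ 0)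
    (h2 : 1 - α * β * q ^ 2 * (q ^ n) ^ 2 ≠ 0)
    (h3 : 1 - α * β * q * (q ^ (n + 1)) ^ 2 ≠ 0)
    (h4 : 1 - α * β * q ^ 2 * (q ^ (n + 1)) ^ 2 ≠ 0) (s : ℤ) :
    (q ^ (-s) - 1) * (1 - δ * γ * q ^ (s + 1)) * qRacah q α β γ δ (n + 1) s =
      qRacah q α β γ δ (n + 2) s -
        (qRecA q α β γ δ (q ^ (n + 1)) + qRecC q α β γ δ (q ^ (n + 1))) *
          qRacah q α β γ δ (n + 1) s +
        qRecA q α β γ δ (q ^ n) * qRecC q α β γ δ (q ^ (n + 1)) * qRacah q α β γ δ n s := by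
  have hyz : q ^ (-s) * (δ * γ * q ^ (s + 1)) = δ * γ * q := by
    rw [zpow_add₀ hq, zpow_neg, zpow_one]
    have := zpow_ne_zero s hq
    field_simp
  have h5 : 1 - α * β * (q ^ (n + 1)) ^ 2 ≠ 0 := by convert h2 using 2; ring
  have key := qSum_recurrence hq (pow_ne_zero (n + 1) hq) α β γ δ _ _ hyz h5 h3 h4 (n + 2) hL
  have hz : qUpper (α * β) q (q ^ (n + 1)) (n + 2) = 0 := by
    rw [qUpper, qPoch_inv_pow_eq_zero hq (by omega), zero_mul]
  rw [hz, zero_mul, zero_div, neg_zero, ← pow_succ,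
    show q ^ (n + 1) / q = q ^ n by rw [pow_succ]; field_simp] at key
  rw [qRacah_eq hq α β γ δ n (n + 2) (by omega), qRacah_eq hq α β γ δ (n + 1) (n + 2) (by omega),
    qRacah_eq hq α β γ δ (n + 2) (n + 2) le_rfl,
    qRacahZero_succ q α β γ δ (n + 1) hb hP', qRacahZero_succ q α β γ δ n ha hP]
  linear_combination qRecA q α β γ δ (q ^ n) * qRacahZero q α β γ δ n * key

lemma qRacah_index_zero (q α β γ δ : ℂ) (s : ℤ) : qRacah q α β γ δ 0 s = 1 := by
  simp [qRacah, qPoch]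

lemma qRacah_index_one {q : ℂ} (hq : q ≠ 0) (α β γ δ : ℂ)
    (hL : qLower q α β γ δ 1 ≠ 0) (h : 1 - α * β * q ^ 2 ≠ 0) (s : ℤ) :
    qRacah q α β γ δ 1 s - qRacah q α β γ δ 1 0 =
      (q ^ (-s) - 1) * (1 - δ * γ * q ^ (s + 1)) := by
  rw [qRacah_zero hq, qRacah_eq hq α β γ δ 1 1 le_rfl]
  simp only [qLower, qPoch, Finset.prod_range_one, pow_zero, mul_one, ne_eq, mul_eq_zero,
    not_or] at hL
  obtain ⟨⟨⟨ha, hb⟩, hc⟩, hd⟩ := hL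
  have hS (y z : ℂ) : qSum q α β γ δ y z (q ^ 1) 1 =
      1 + (1 - q⁻¹) * (1 - α * β * q * q) * ((1 - y) * (1 - z)) /
        ((1 - α * q) * (1 - β * δ * q) * (1 - γ * q) * (1 - q)) * q := by
    simp [qSum, Finset.sum_range_succ, qLower, qUpper, qPoch]
  have hZ : qRacahZero q α β γ δ 1 =
      (1 - α * q) * (1 - β * δ * q) * (1 - γ * q) / (1 - α * β * q ^ 2) := by
    simp [qRacahZero, qPoch]
  rw [hS, hZ]
  generalize q ^ (-s) = y
  generalize δ * γ * q ^ (s + 1) = z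
  rw [mul_assoc (α * β) q q, ← pow_two]
  generalize 1 - α * β * q ^ 2 = T at *
  generalize 1 - α * q = U1 at *
  generalize 1 - β * δ * q = U2 at *
  generalize 1 - γ * q = U3 at *
  have hq' : 1 - q⁻¹ = -(1 - q) / q := by field_simp; ring
  rw [hq']
  generalize 1 - q = U4 at *
  field_simp
  ring

/-- The Christoffel–Darboux formula for `q`-Racah polynomials, with second argument `0`. -/
lemma qKer_christoffelDarboux {q : ℂ} (hq : q ≠ 0) (α β γ δ : ℂ) (N : ℕ)
    (hL : ∀ k ≤ N, qLower q α β γ δ k ≠ 0)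
    (hP : ∀ k ≤ N, qPoch (α * β * q ^ (k + 1)) q k ≠ 0)
    (hnorm : ∀ k ≤ N, qRacahNormSq q α β γ δ k ≠ 0) (n : ℕ) (hn : n + 1 ≤ N) (s : ℤ) :
    (q ^ (-s) - 1) * (1 - δ * γ * q ^ (s + 1)) * qKer q α β γ δ (n + 1) s 0 *
        qRacahNormSq q α β γ δ n =
      qRacah q α β γ δ (n + 1) s * qRacah q α β γ δ n 0 -
        qRacah q α β γ δ n s * qRacah q α β γ δ (n + 1) 0 := by
  have hodd : ∀ k ≤ N, 1 - α * β * q * (q ^ k) ^ 2 ≠ 0 := by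
    intro k hk h
    apply hnorm k hk
    rw [qRacahNormSq_eq, h]
    simp
  have hpoch : ∀ k ≤ N, qPoch (α * β * q) q k ≠ 0 := by
    intro k hk h
    apply hnorm k hk
    rw [qRacahNormSq_eq, h]
    simp
  have heven : ∀ k, k + 1 ≤ N → 1 - α * β * q ^ 2 * (q ^ k) ^ 2 ≠ 0 := by
    intro k hk
    convert one_sub_ne_zero_of_qPoch (hP (k + 1) hk) (Nat.lt_succ_self k) using 2
    ring
  have hone : ∀ k, k + 1 ≤ N → 1 - α * β * q ^ (k + 1) ≠ 0 := by
    intro k hk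
    convert one_sub_ne_zero_of_qPoch (hpoch (k + 1) hk) (Nat.lt_succ_self k) using 2
    ring
  have hγδ : δ * γ * q ≠ 0 := by
    intro h
    apply hnorm 1 (by omega)
    rw [qRacahNormSq_eq, h]
    simp
  have hδ : δ ≠ 0 := by rintro rfl; simp at hγδ
  have hγ : γ ≠ 0 := by rintro rfl; simp at hγδ
  induction n with
  | zero =>
    have hc := hone 0 hn
    have hd : qRacahNormSq q α β γ δ 0 = 1 := by
      have := hodd 0 (by omega)
      rw [qRacahNormSq_eq]
      simp only [pow_zero, one_pow, mul_one, qPoch_zero, div_one] at this ⊢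
      exact div_self this
    have hK : qKer q α β γ δ (0 + 1) s 0 = 1 := by
      simp [qKer, qRacah_index_zero, hd]
    have h2 := heven 0 hn
    simp only [pow_zero, one_pow, mul_one] at h2
    have := qRacah_index_one hq α β γ δ (hL 1 hn) h2 s
    rw [hK, hd, qRacah_index_zero, qRacah_index_zero, zero_add]
    linear_combination -this
  | succ n ih =>
    have ih := ih (by omega)
    have hrec := qRacah_recurrence hq α β γ δ n (fun k hk => hL k (by omega))
      (hone n (by omega)) (hone (n + 1) hn) (hP n (by omega)) (hP (n + 1) (by omega))
      (heven n (by omega)) (hodd (n + 1) (by omega)) (heven (n + 1) hn)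
    have hd := qRacahNormSq_succ q α β γ δ n hγ hδ (hone n (by omega)) (hP n (by omega))
      (hpoch n (by omega)) (hodd n (by omega)) (heven n (by omega)) (hodd (n + 1) (by omega))
    have hs := hrec s
    have h0 := hrec 0
    rw [neg_zero, zpow_zero, sub_self, zero_mul, zero_mul] at h0
    have hK : qKer q α β γ δ (n + 1 + 1) s 0 * qRacahNormSq q α β γ δ (n + 1) =
        qKer q α β γ δ (n + 1) s 0 * qRacahNormSq q α β γ δ (n + 1) +
          qRacah q α β γ δ (n + 1) s * qRacah q α β γ δ (n + 1) 0 := by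
      rw [qKer, Finset.sum_range_succ, ← qKer, add_mul, div_mul_cancel₀ _ (hnorm _ (by omega))]
    rw [mul_assoc, hK, hd]
    linear_combination qRecA q α β γ δ (q ^ n) * qRecC q α β γ δ (q ^ (n + 1)) * ih +
      qRacah q α β γ δ (n + 1) 0 * hs - qRacah q α β γ δ (n + 1) s * h0

/-- the second representation formula in the one-mass-point case:
`φ₀(s) R_n^{α,β,A}(s) = A(s,n) R_n(s) + B(s,n) R_{n-1}(s)` with
`φ₀(s) = (q^{-s}-1)(1-δγq^{s+1})`. -/
theorem qRacahKrallA_second_representation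
    (q : ℝ) (hq0 : 0 < q) (hq1 : q < 1) (α β γ δ : ℂ) (N : ℕ)
    (htrunc : α * (q : ℂ) = (q : ℂ) ^ (-(N : ℤ)) ∨ β * δ * (q : ℂ) = (q : ℂ) ^ (-(N : ℤ)) ∨
      γ * (q : ℂ) = (q : ℂ) ^ (-(N : ℤ)))
    (hpoch : ∀ k : ℕ, k ≤ N → qPoch (α * (q : ℂ)) (q : ℂ) k ≠ 0 ∧
      qPoch (β * δ * (q : ℂ)) (q : ℂ) k ≠ 0 ∧ qPoch (γ * (q : ℂ)) (q : ℂ) k ≠ 0 ∧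
      qPoch (q : ℂ) (q : ℂ) k ≠ 0)
    (hpoch2 : ∀ k : ℕ, k ≤ N → qPoch (α * β * (q : ℂ) ^ ((k : ℤ) + 1)) (q : ℂ) k ≠ 0)
    (hnorm : ∀ k : ℕ, k ≤ N → qRacahNormSq (q : ℂ) α β γ δ k ≠ 0)
    (n : ℕ) (hn1 : 1 ≤ n) (hnN : n ≤ N)
    (A : ℂ)
    (hκ : 1 + A * qKer (q : ℂ) α β γ δ n 0 0 ≠ 0)
    (s : ℤ) :
    ((q : ℂ) ^ (-s) - 1) * (1 - δ * γ * (q : ℂ) ^ (s + 1)) *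
        qRacahKrallA (q : ℂ) α β γ δ A n s =
      (((q : ℂ) ^ (-s) - 1) * (1 - δ * γ * (q : ℂ) ^ (s + 1)) -
          A / qRacahNormSq (q : ℂ) α β γ δ (n - 1) * qKrallA0 (q : ℂ) α β γ δ A n *
            qRacah (q : ℂ) α β γ δ (n - 1) 0) *
        qRacah (q : ℂ) α β γ δ n s +
        A / qRacahNormSq (q : ℂ) α β γ δ (n - 1) * qKrallA0 (q : ℂ) α β γ δ A n *
            qRacah (q : ℂ) α β γ δ n 0 *
          qRacah (q : ℂ) α β γ δ (n - 1) s := by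
  have hq : (q : ℂ) ≠ 0 := by exact_mod_cast hq0.ne'
  obtain ⟨m, rfl⟩ : ∃ m, n = m + 1 := ⟨n - 1, by omega⟩
  have hP : ∀ k ≤ N, qPoch (α * β * (q : ℂ) ^ (k + 1)) q k ≠ 0 := by
    intro k hk
    have := hpoch2 k hk
    rwa [show (q : ℂ) ^ ((k : ℤ) + 1) = (q : ℂ) ^ (k + 1) by
      exact_mod_cast zpow_natCast (q : ℂ) (k + 1)] at this
  have hL : ∀ k ≤ N, qLower (q : ℂ) α β γ δ k ≠ 0 := by
    intro k hk
    obtain ⟨h1, h2, h3, h4⟩ := hpoch k hk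
    exact mul_ne_zero (mul_ne_zero (mul_ne_zero h1 h2) h3) h4
  have cd := qKer_christoffelDarboux hq α β γ δ N hL hP hnorm m hnN s
  have hd := hnorm m (by omega)
  rw [Nat.add_sub_cancel, qRacahKrallA]
  generalize ((q : ℂ) ^ (-s) - 1) * (1 - δ * γ * (q : ℂ) ^ (s + 1)) = φ at *
  rw [← eq_div_iff hd] at cd
  linear_combination -A * qKrallA0 (q : ℂ) α β γ δ A (m + 1) * cd
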